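/- arXiv:2102.11610 — 11 statements merged into one kernel-verified Lean document; each statement's English description precedes it below -/
import Mathlib

section
/- Let B be a nonempty set and let S = (S_b)_{b ∈ B} be a family of subgroups of the free abelian group ℤ_B on B with b ∈ S_b for every b ∈ B. Then the operation ▷ on Q(S) satisfies all of the following, so Q(S) is a translation-commutative quandle: (i) x ▷ x = x for all x; (ii) for each y ∈ A_c, the map x ↦ x ▷ y is a bijection of Q(S), with inverse sending x ∈ A_b to x − (c + S_b); (iii) (w ▷ x) ▷ y = (w ▷ y) ▷ (x ▷ y) for all w, x, y; (iv) (x ▷ y) ▷ z = (x ▷ z) ▷ y for all x, y, z. -/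
/-- The disjoint union `Q(S) = ⨆ b, ℤ_B / S_b` (as a sigma type). -/
abbrev QS {B : Type*} (S : B → AddSubgroup (FreeAbelianGroup B)) :=
  (b : B) × (FreeAbelianGroup B ⧸ S b)

/-- The quandle operation on `Q(S)`: for `x ∈ A_b` and `y ∈ A_c`,
`x ▷ y = x + (c + S_b) ∈ A_b`. -/
def qsOp {B : Type*} (S : B → AddSubgroup (FreeAbelianGroup B)) (x y : QS S) : QS S :=
  ⟨x.1, x.2 + QuotientAddGroup.mk (FreeAbelianGroup.of y.1)⟩

/-- Translation by `y` undoes subtracting the class of the index of `y`. -/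
theorem qsOp_sub_cancel {B : Type*} (S : B → AddSubgroup (FreeAbelianGroup B)) (x y : QS S) :
    qsOp S (⟨x.1, x.2 - QuotientAddGroup.mk (FreeAbelianGroup.of y.1)⟩ : QS S) y = x :=
  Sigma.ext rfl (heq_of_eq (sub_add_cancel _ _))

/-- Subtracting the class of the index of `y` undoes translation by `y`. -/
theorem qsOp_add_sub_cancel {B : Type*} (S : B → AddSubgroup (FreeAbelianGroup B)) (x y : QS S) :
    (⟨(qsOp S x y).1,
      (qsOp S x y).2 - QuotientAddGroup.mk (FreeAbelianGroup.of y.1)⟩ : QS S) = x :=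
  Sigma.ext rfl (heq_of_eq (add_sub_cancel_right _ _))

/-- Translations of `Q(S)` commute. -/
theorem qsOp_right_comm {B : Type*} (S : B → AddSubgroup (FreeAbelianGroup B)) (x y z : QS S) :
    qsOp S (qsOp S x y) z = qsOp S (qsOp S x z) y :=
  Sigma.ext rfl (heq_of_eq (add_right_comm _ _ _))

/-- Proposition 2.2: `Q(S)` is a translation-commutative quandle. -/
theorem stmt0 {B : Type*} [Nonempty B] (S : B → AddSubgroup (FreeAbelianGroup B))
    (hS : ∀ b : B, FreeAbelianGroup.of b ∈ S b) :
    -- (i) idempotence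
    (∀ x : QS S, qsOp S x x = x) ∧
    -- (ii) each translation is a bijection, with inverse `x ↦ x - (c + S_b)`
    (∀ y : QS S, Function.Bijective (fun x : QS S => qsOp S x y) ∧
      (∀ x : QS S,
        qsOp S (⟨x.1, x.2 - QuotientAddGroup.mk (FreeAbelianGroup.of y.1)⟩ : QS S) y = x) ∧
      (∀ x : QS S,
        (⟨(qsOp S x y).1,
          (qsOp S x y).2 - QuotientAddGroup.mk (FreeAbelianGroup.of y.1)⟩ : QS S) = x)) ∧
    -- (iii) right self-distributivity
    (∀ w x y : QS S, qsOp S (qsOp S w x) y = qsOp S (qsOp S w y) (qsOp S x y)) ∧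
    -- (iv) translation-commutativity
    (∀ x y z : QS S, qsOp S (qsOp S x y) z = qsOp S (qsOp S x z) y) := by
  refine ⟨fun x => ?_, fun y => ⟨?_, fun x => qsOp_sub_cancel S x y,
    fun x => qsOp_add_sub_cancel S x y⟩, fun w x y => qsOp_right_comm S w x y, qsOp_right_comm S⟩
  · refine Sigma.ext rfl (heq_of_eq ?_)
    change x.2 + QuotientAddGroup.mk (FreeAbelianGroup.of x.1) = x.2
    rw [(QuotientAddGroup.eq_zero_iff _).mpr (hS x.1), add_zero]
  · refine ⟨fun x x' h => ?_, fun x => ⟨_, qsOp_sub_cancel S x y⟩⟩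
    replace h : qsOp S x y = qsOp S x' y := h
    rw [← qsOp_add_sub_cancel S x y, h, qsOp_add_sub_cancel S x' y]
end

section
/- Let B be a nonempty set, S = (S_b)_{b ∈ B} a family of subgroups of ℤ_B with b ∈ S_b for all b, and consider the quandle Q(S). Suppose n ∈ ℕ, b_1, …, b_n ∈ B and m_1, …, m_n ∈ ℤ; let y = Σ_{i=1}^n m_i·b_i ∈ ℤ_B and let β_y = β_{b_1}^{m_1} ∘ ⋯ ∘ β_{b_n}^{m_n}, where β_b denotes the translation of Q(S) by any element of A_b (all elements of A_b induce the same translation). Then for each b ∈ B the following are equivalent: (1) y ∈ S_b; (2) there exists x ∈ A_b with β_y(x) = x; (3) for every x ∈ A_b, β_y(x) = x. -/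
/-- The translation `β_c` of `Q(S)` induced by any element of the summand `A_c`:
it sends `x ∈ A_b` to `x ▷ y = x + (c + S_b)` for `y ∈ A_c`. -/
def qsBeta {B : Type*} (S : B → AddSubgroup (FreeAbelianGroup B)) (c : B) :
    Equiv.Perm (QS S) where
  toFun x := ⟨x.1, x.2 + QuotientAddGroup.mk (FreeAbelianGroup.of c)⟩
  invFun x := ⟨x.1, x.2 - QuotientAddGroup.mk (FreeAbelianGroup.of c)⟩
  left_inv x := by cases x with | mk b xb => simp
  right_inv x := by cases x with | mk b xb => simp

theorem qsBeta_zpow_apply {B : Type*} (S : B → AddSubgroup (FreeAbelianGroup B)) (c b : B)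
    (m : ℤ) (x : FreeAbelianGroup B ⧸ S b) :
    (qsBeta S c ^ m) ⟨b, x⟩ =
      ⟨b, x + QuotientAddGroup.mk (m • FreeAbelianGroup.of c)⟩ := by
  induction m generalizing x with
  | zero => simp
  | succ k ih =>
    rw [zpow_add_one, Equiv.Perm.mul_apply]
    change (qsBeta S c ^ (k : ℤ)) ⟨b, x + QuotientAddGroup.mk (FreeAbelianGroup.of c)⟩ = _
    rw [ih, add_assoc, ← QuotientAddGroup.mk_add, add_smul, one_smul,
      add_comm (FreeAbelianGroup.of c)]
  | pred k ih =>
    rw [zpow_sub_one, Equiv.Perm.mul_apply]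
    change (qsBeta S c ^ (-k : ℤ)) ⟨b, x - QuotientAddGroup.mk (FreeAbelianGroup.of c)⟩ = _
    rw [ih, sub_add_eq_add_sub, add_sub_assoc, ← QuotientAddGroup.mk_sub, sub_smul, one_smul]

theorem prod_qsBeta_zpow_apply {B : Type*} (S : B → AddSubgroup (FreeAbelianGroup B))
    {n : ℕ} (bs : Fin n → B) (ms : Fin n → ℤ) (b : B) (x : FreeAbelianGroup B ⧸ S b) :
    (List.ofFn fun i => qsBeta S (bs i) ^ ms i).prod ⟨b, x⟩ =
      ⟨b, x + QuotientAddGroup.mk (∑ i, ms i • FreeAbelianGroup.of (bs i))⟩ := by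
  induction n with
  | zero => simp
  | succ n ih =>
    rw [List.ofFn_succ, List.prod_cons, Equiv.Perm.mul_apply, ih, qsBeta_zpow_apply,
      Fin.sum_univ_succ, add_assoc, ← QuotientAddGroup.mk_add, add_comm (∑ i : Fin n, _)]

/-- Lemma 2.3: for `y = Σ m_i · b_i ∈ ℤ_B` and `β_y = β_{b_1}^{m_1} ∘ ⋯ ∘ β_{b_n}^{m_n}`,
the conditions `y ∈ S_b`, `β_y` fixes some point of `A_b`, and `β_y` fixes every point
of `A_b` are equivalent. -/
theorem stmt1 {B : Type*} [Nonempty B] (S : B → AddSubgroup (FreeAbelianGroup B))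
    (hS : ∀ b : B, FreeAbelianGroup.of b ∈ S b)
    (n : ℕ) (bs : Fin n → B) (ms : Fin n → ℤ)
    (y : FreeAbelianGroup B) (hy : y = ∑ i : Fin n, ms i • FreeAbelianGroup.of (bs i))
    (βy : Equiv.Perm (QS S)) (hβy : βy = (List.ofFn fun i : Fin n => (qsBeta S (bs i)) ^ (ms i)).prod)
    (b : B) :
    (y ∈ S b ↔ ∃ x : FreeAbelianGroup B ⧸ S b, βy ⟨b, x⟩ = ⟨b, x⟩) ∧
    ((∃ x : FreeAbelianGroup B ⧸ S b, βy ⟨b, x⟩ = ⟨b, x⟩) ↔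
      ∀ x : FreeAbelianGroup B ⧸ S b, βy ⟨b, x⟩ = ⟨b, x⟩) := by
  have fixed_iff (x : FreeAbelianGroup B ⧸ S b) : βy ⟨b, x⟩ = ⟨b, x⟩ ↔ y ∈ S b := by
    rw [hβy, prod_qsBeta_zpow_apply, ← hy, Sigma.mk.injEq, heq_eq_eq, add_eq_left,
      QuotientAddGroup.eq_zero_iff]
    exact and_iff_right rfl
  simp only [fixed_iff, exists_const, forall_const, and_self]
end

section
/- Let B be a nonempty set and S = (S_b)_{b ∈ B} a family of subgroups of ℤ_B with b ∈ S_b for all b. Then the orbits of the quandle Q(S) are exactly the subsets A_b: two elements of Q(S) belong to the same orbit if and only if they belong to the same summand A_b. -/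
/-- Translating by the class of any element of `ℤ_B` stays within an orbit. -/
theorem eqvGen_qsOp_add_mk {B : Type*} (S : B → AddSubgroup (FreeAbelianGroup B)) (b : B)
    (g : FreeAbelianGroup B) (a : FreeAbelianGroup B ⧸ S b) :
    Relation.EqvGen (fun u v : QS S => ∃ y : QS S, v = qsOp S u y)
      ⟨b, a⟩ ⟨b, a + QuotientAddGroup.mk g⟩ := by
  induction g using FreeAbelianGroup.induction_on generalizing a with
  | zero => simpa using Relation.EqvGen.refl _
  | of c => exact .rel _ _ ⟨⟨c, 0⟩, rfl⟩
  | neg c _ =>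
    refine .symm _ _ (.rel _ _ ⟨⟨c, 0⟩, ?_⟩)
    simp [qsOp]
  | add g h ihg ihh =>
    rw [QuotientAddGroup.mk_add, ← add_assoc]
    exact .trans _ _ _ (ihg a) (ihh _)

/-- The orbits of the quandle `Q(S)` are exactly the summands `A_b`: two elements
lie in the same orbit (the equivalence relation generated by `u ∼ u ▷ y`) if and only
if they lie in the same summand. -/
theorem stmt2 {B : Type*} [Nonempty B] (S : B → AddSubgroup (FreeAbelianGroup B))
    (hS : ∀ b : B, FreeAbelianGroup.of b ∈ S b) (x z : QS S) :
    Relation.EqvGen (fun u v : QS S => ∃ y : QS S, v = qsOp S u y) x z ↔ x.1 = z.1 := by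
  constructor
  · intro h
    induction h with
    | rel u v h =>
      obtain ⟨y, rfl⟩ := h
      rfl
    | refl => rfl
    | symm _ _ _ ih => exact ih.symm
    | trans _ _ _ _ _ ih₁ ih₂ => exact ih₁.trans ih₂
  · obtain ⟨b, a⟩ := x
    obtain ⟨c, d⟩ := z
    rintro rfl
    obtain ⟨g, hg⟩ := QuotientAddGroup.mk_surjective (d - a)
    simpa [hg] using eqvGen_qsOp_add_mk S b g a
end

section
/- Let B and B' be nonempty sets, S = (S_b)_{b ∈ B} a family of subgroups of ℤ_B with b ∈ S_b for all b ∈ B, and S' = (S'_{b'})_{b' ∈ B'} a family of subgroups of ℤ_{B'} with b' ∈ S'_{b'} for all b' ∈ B'. If the quandles Q(S) and Q(S') are isomorphic, then there is a bijection f : B → B' such that the induced group homomorphism f : ℤ_B → ℤ_{B'} satisfies f(S_b) = S'_{f(b)} for all b ∈ B; moreover, any quandle isomorphism g : Q(S) → Q(S') satisfies g(A_b) = A'_{f(b)} for such an f. -/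
/-- Translation of `Q(S)` by an element of `ℤ_B`. -/
def qsTranslate {B : Type*} (S : B → AddSubgroup (FreeAbelianGroup B))
    (v : FreeAbelianGroup B) (x : QS S) : QS S :=
  ⟨x.1, x.2 + QuotientAddGroup.mk v⟩

theorem qsTranslate_zero {B : Type*} (S : B → AddSubgroup (FreeAbelianGroup B)) (x : QS S) :
    qsTranslate S 0 x = x := by
  simp [qsTranslate]

theorem qsTranslate_add {B : Type*} (S : B → AddSubgroup (FreeAbelianGroup B))
    (v w : FreeAbelianGroup B) (x : QS S) :
    qsTranslate S (v + w) x = qsTranslate S v (qsTranslate S w x) := by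
  simp only [qsTranslate, QuotientAddGroup.mk_add]
  congr 1
  abel

theorem qsTranslate_eq_self_iff {B : Type*} (S : B → AddSubgroup (FreeAbelianGroup B))
    (v : FreeAbelianGroup B) (x : QS S) : qsTranslate S v x = x ↔ v ∈ S x.1 := by
  obtain ⟨b, a⟩ := x
  simp [qsTranslate]

theorem exists_qsTranslate_eq {B : Type*} (S : B → AddSubgroup (FreeAbelianGroup B))
    (x : QS S) : ∃ v, qsTranslate S v ⟨x.1, 0⟩ = x := by
  obtain ⟨b, a⟩ := x
  obtain ⟨v, rfl⟩ := QuotientAddGroup.mk_surjective a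
  exact ⟨v, by simp [qsTranslate]⟩

/-- The map on index sets induced by a map `Q(S) → Q(S')`, read off at the zero elements. -/
def qsIndexMap {B B' : Type*} {S : B → AddSubgroup (FreeAbelianGroup B)}
    {S' : B' → AddSubgroup (FreeAbelianGroup B')} (g : QS S → QS S') (b : B) : B' :=
  (g ⟨b, 0⟩).1

section Hom

variable {B B' : Type*} {S : B → AddSubgroup (FreeAbelianGroup B)}
  {S' : B' → AddSubgroup (FreeAbelianGroup B')} {g : QS S → QS S'}

theorem map_qsTranslate (hg : ∀ x y : QS S, g (qsOp S x y) = qsOp S' (g x) (g y))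
    (v : FreeAbelianGroup B) (x : QS S) :
    g (qsTranslate S v x) =
      qsTranslate S' (FreeAbelianGroup.map (qsIndexMap g) v) (g x) := by
  have hof (b : B) (x : QS S) : g (qsTranslate S (FreeAbelianGroup.of b) x) =
      qsTranslate S' (FreeAbelianGroup.of (qsIndexMap g b)) (g x) :=
    hg x ⟨b, 0⟩
  induction v using FreeAbelianGroup.induction_on generalizing x with
  | zero => simp [qsTranslate_zero]
  | of b => simpa using hof b x
  | neg b _ =>
    have h := hof b (qsTranslate S (-FreeAbelianGroup.of b) x)
    rw [← qsTranslate_add, add_neg_cancel, qsTranslate_zero] at h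
    rw [h, ← qsTranslate_add, map_neg, FreeAbelianGroup.map_of_apply, neg_add_cancel,
      qsTranslate_zero]
  | add v w hv hw => rw [qsTranslate_add, hv, hw, map_add, qsTranslate_add]

theorem fst_map_eq_qsIndexMap (hg : ∀ x y : QS S, g (qsOp S x y) = qsOp S' (g x) (g y))
    (x : QS S) : (g x).1 = qsIndexMap g x.1 := by
  obtain ⟨v, hv⟩ := exists_qsTranslate_eq S x
  rw [← hv, map_qsTranslate hg]
  rfl

end Hom

theorem qsIndexMap_bijective {B B' : Type*} {S : B → AddSubgroup (FreeAbelianGroup B)}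
    {S' : B' → AddSubgroup (FreeAbelianGroup B')} (g : QS S ≃ QS S')
    (hg : ∀ x y : QS S, g (qsOp S x y) = qsOp S' (g x) (g y)) :
    Function.Bijective (qsIndexMap g) := by
  have hg' (x y : QS S') : g.symm (qsOp S' x y) = qsOp S (g.symm x) (g.symm y) := by
    rw [Equiv.symm_apply_eq, hg, g.apply_symm_apply, g.apply_symm_apply]
  refine Function.bijective_iff_has_inverse.2 ⟨qsIndexMap g.symm, fun b => ?_, fun b' => ?_⟩
  · conv_lhs => rw [qsIndexMap.eq_def g, ← fst_map_eq_qsIndexMap hg', g.symm_apply_apply]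
  · conv_lhs => rw [qsIndexMap.eq_def g.symm, ← fst_map_eq_qsIndexMap hg, g.apply_symm_apply]

theorem map_qsIndexMap_mem_iff {B B' : Type*} {S : B → AddSubgroup (FreeAbelianGroup B)}
    {S' : B' → AddSubgroup (FreeAbelianGroup B')} (g : QS S ≃ QS S')
    (hg : ∀ x y : QS S, g (qsOp S x y) = qsOp S' (g x) (g y))
    (b : B) (v : FreeAbelianGroup B) :
    FreeAbelianGroup.map (qsIndexMap g) v ∈ S' (qsIndexMap g b) ↔ v ∈ S b := by
  rw [← qsTranslate_eq_self_iff S v ⟨b, 0⟩, ← g.injective.eq_iff, map_qsTranslate hg,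
    qsTranslate_eq_self_iff]
  rfl

/-- Proposition 2.4, second half: any quandle isomorphism `g : Q(S) → Q(S')` gives rise
to a bijection `f : B → B'` whose induced homomorphism `ℤ_B → ℤ_{B'}` carries each `S_b`
onto `S'_{f(b)}`, and `g` carries each summand `A_b` onto `A'_{f(b)}`. -/
theorem stmt4 {B B' : Type*} [Nonempty B] [Nonempty B']
    (S : B → AddSubgroup (FreeAbelianGroup B))
    (hS : ∀ b : B, FreeAbelianGroup.of b ∈ S b)
    (S' : B' → AddSubgroup (FreeAbelianGroup B'))
    (hS' : ∀ b' : B', FreeAbelianGroup.of b' ∈ S' b')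
    (g : QS S ≃ QS S')
    (hg : ∀ x y : QS S, g (qsOp S x y) = qsOp S' (g x) (g y)) :
    ∃ f : B → B', Function.Bijective f ∧
      (∀ b : B, AddSubgroup.map (FreeAbelianGroup.map f) (S b) = S' (f b)) ∧
      (∀ b : B, ⇑g '' {x : QS S | x.1 = b} = {y : QS S' | y.1 = f b}) := by
  have hbij := qsIndexMap_bijective g hg
  refine ⟨qsIndexMap g, hbij, fun b => ?_, fun b => ?_⟩
  · ext w
    obtain ⟨v, rfl⟩ : ∃ v, FreeAbelianGroup.map (qsIndexMap g) v = w :=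
      (FreeAbelianGroup.equivOfEquiv (Equiv.ofBijective _ hbij)).surjective w
    rw [map_qsIndexMap_mem_iff g hg]
    refine ⟨?_, AddSubgroup.mem_map_of_mem _⟩
    rintro ⟨u, hu, huv⟩
    rw [← map_qsIndexMap_mem_iff g hg, ← huv]
    exact (map_qsIndexMap_mem_iff g hg b u).2 hu
  · ext y
    obtain ⟨x, rfl⟩ := g.surjective y
    simp [fst_map_eq_qsIndexMap hg, hbij.injective.eq_iff]
end

section
/- Let B be a nonempty set, b ∈ B, and let x, y ∈ ℤ_B be elements whose coefficient on the generator b is zero (i.e., x and y lie in the subgroup ℤ_{B∖{b}} of ℤ_B generated by the generators other than b). Then the subgroup of ℤ_B generated by {b, x} equals the subgroup generated by {b, y} if and only if x = y or x = −y. -/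
open FreeAbelianGroup in
theorem FreeAbelianGroup.coeff_eq_zero_of_mem_closure {B : Type*} {b : B} {x : FreeAbelianGroup B}
    (hx : x ∈ AddSubgroup.closure (of '' {c : B | c ≠ b})) : coeff b x = 0 := by
  have hle : AddSubgroup.closure (of '' {c : B | c ≠ b}) ≤ (coeff b).ker := by
    rw [AddSubgroup.closure_le]
    rintro _ ⟨c, hc, rfl⟩
    simpa [coeff, AddMonoidHom.mem_ker] using Finsupp.single_eq_of_ne (Ne.symm hc)
  exact hle hx

open FreeAbelianGroup in
theorem FreeAbelianGroup.exists_eq_zsmul_of_mem_closure_pair {B : Type*} {b : B}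
    {x y : FreeAbelianGroup B} (hx : coeff b x = 0) (hy : coeff b y = 0)
    (h : x ∈ AddSubgroup.closure {of b, y}) : ∃ n : ℤ, x = n • y := by
  obtain ⟨m, n, rfl⟩ := AddSubgroup.mem_closure_pair.1 h
  have hb : coeff b (of b) = 1 := by simp [coeff]
  have hm : m = 0 := by simpa [hb, hy] using hx
  exact ⟨n, by simp [hm]⟩

theorem FreeAbelianGroup.eq_or_eq_neg_of_eq_zsmul {B : Type*} {x y : FreeAbelianGroup B} {m n : ℤ}
    (hx : x = m • y) (hy : y = n • x) : x = y ∨ x = -y := by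
  by_cases h0 : x = 0
  · exact Or.inl (by rw [hy, h0, smul_zero])
  obtain ⟨c, hc⟩ : ∃ c, coeff c x ≠ 0 := by
    by_contra! h
    exact h0 (by rw [eq_sum_support_coeff_smul_of x]; simp [h])
  have hmul : coeff c x = m * n * coeff c x := by
    conv_lhs => rw [hx, hy]
    simp [mul_assoc]
  have hmn : m * n = 1 := by
    simpa [hc] using hmul
  rcases Int.eq_one_or_neg_one_of_mul_eq_one hmn with rfl | rfl
  · exact Or.inl (by simpa using hx)
  · exact Or.inr (by simpa using hx)

/-- Key step of Corollary 2.5: if `b ∈ B` and `x, y ∈ ℤ_{B∖{b}}` (the subgroup of `ℤ_B`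
generated by the free generators other than `b`), then `{b, x}` and `{b, y}` generate
the same subgroup of `ℤ_B` if and only if `x = ± y`. -/
theorem stmt5 {B : Type*} [Nonempty B] (b : B) (x y : FreeAbelianGroup B)
    (hx : x ∈ AddSubgroup.closure (FreeAbelianGroup.of '' {c : B | c ≠ b}))
    (hy : y ∈ AddSubgroup.closure (FreeAbelianGroup.of '' {c : B | c ≠ b})) :
    AddSubgroup.closure {FreeAbelianGroup.of b, x} =
      AddSubgroup.closure {FreeAbelianGroup.of b, y} ↔ x = y ∨ x = -y := by
  have hx0 := FreeAbelianGroup.coeff_eq_zero_of_mem_closure hx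
  have hy0 := FreeAbelianGroup.coeff_eq_zero_of_mem_closure hy
  constructor
  · intro h
    obtain ⟨m, hm⟩ := FreeAbelianGroup.exists_eq_zsmul_of_mem_closure_pair hx0 hy0
      (h ▸ AddSubgroup.subset_closure (by simp))
    obtain ⟨n, hn⟩ := FreeAbelianGroup.exists_eq_zsmul_of_mem_closure_pair hy0 hx0
      (h ▸ AddSubgroup.subset_closure (by simp))
    exact FreeAbelianGroup.eq_or_eq_neg_of_eq_zsmul hm hn
  · rintro (rfl | rfl)
    · rfl
    · simp only [Set.insert_eq, AddSubgroup.closure_union, AddSubgroup.closure_singleton_neg]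
end

section
/- Let Q be a translation-commutative quandle. Then for all x, y ∈ Q, the translation by y ▷ x equals the translation by y, i.e., w ▷ (y ▷ x) = w ▷ y for all w ∈ Q. Consequently β_y = β_z whenever z belongs to the orbit of y in Q. -/
/-- Lemma 2.6: in a translation-commutative quandle, the translation by `y ▷ x` equals
the translation by `y`; consequently `β_y = β_z` whenever `z` lies in the orbit of `y`
(the equivalence relation generated by `u ∼ u ▷ w`). -/
theorem stmt7 {Q : Type*} (op : Q → Q → Q)
    (h1 : ∀ x : Q, op x x = x)
    (h2 : ∀ y : Q, Function.Bijective (fun x : Q => op x y))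
    (h3 : ∀ w x y : Q, op (op w x) y = op (op w y) (op x y))
    (htc : ∀ x y z : Q, op (op x y) z = op (op x z) y) :
    (∀ x y w : Q, op w (op y x) = op w y) ∧
    (∀ y z : Q, Relation.EqvGen (fun u v : Q => ∃ w : Q, v = op u w) y z →
      ∀ w : Q, op w z = op w y) := by
  have key : ∀ x y w : Q, op w (op y x) = op w y := by
    intro x y w
    obtain ⟨v, rfl⟩ := (h2 x).surjective w
    exact (h3 v y x).symm.trans (htc v y x)
  refine ⟨key, fun y z h => ?_⟩
  induction h with
  | rel u v huv =>
    obtain ⟨a, rfl⟩ := huv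
    exact key a u
  | refl u => exact fun _ => rfl
  | symm u v _ ih => exact fun w => (ih w).symm
  | trans u v t _ _ ihuv ihvt => exact fun w => (ihvt w).trans (ihuv w)
end

section
/- Let Q be a quandle. The subgroup of the group of bijections of Q generated by the set of translations {β_y : y ∈ Q} (the translation group β(Q)) is commutative if and only if (x ▷ y) ▷ z = (x ▷ z) ▷ y for all x, y, z ∈ Q. -/
/-- A quandle is translation-commutative (Definition 1.4 / formula (1.1)) if and only if
its translation group — the subgroup of the symmetric group of `Q` generated by the
translations `β_y` — is commutative. -/
theorem stmt8 {Q : Type*} (op : Q → Q → Q)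
    (h1 : ∀ x : Q, op x x = x)
    (h2 : ∀ y : Q, Function.Bijective (fun x : Q => op x y))
    (h3 : ∀ w x y : Q, op (op w x) y = op (op w y) (op x y)) :
    (∀ g ∈ Subgroup.closure {e : Equiv.Perm Q | ∃ y : Q, ∀ x : Q, e x = op x y},
      ∀ h ∈ Subgroup.closure {e : Equiv.Perm Q | ∃ y : Q, ∀ x : Q, e x = op x y},
        g * h = h * g) ↔
    (∀ x y z : Q, op (op x y) z = op (op x z) y) := by
  constructor
  · intro hcomm x y z
    have key := hcomm (Equiv.ofBijective _ (h2 z)) (Subgroup.subset_closure ⟨z, fun _ => rfl⟩)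
      (Equiv.ofBijective _ (h2 y)) (Subgroup.subset_closure ⟨y, fun _ => rfl⟩)
    exact DFunLike.congr_fun key x
  · intro hop g hg h hh
    have := Subgroup.isMulCommutative_closure
      (k := {e : Equiv.Perm Q | ∃ y : Q, ∀ x : Q, e x = op x y}) <| by
        rintro a ⟨y, ha⟩ b ⟨z, hb⟩
        ext x
        simp only [Equiv.Perm.mul_apply, ha, hb, hop x z y]
    exact setLike_mul_comm hg hh
end

section
/- Let Q be a translation-commutative quandle, and suppose there is a bijection b ↔ Q_b between a set B and the set of orbits of Q. Then there is a family S = (S_b)_{b ∈ B} of subgroups of the free abelian group ℤ_B, with b ∈ S_b for every b ∈ B, such that Q is isomorphic as a quandle to Q(S); moreover the isomorphism can be chosen to carry each orbit Q_b onto the summand A_b = ℤ_B/S_b. -/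
open scoped IsMulCommutative in
/-- A family of pairwise commuting permutations of `Q` indexed by `B` extends to an additive
homomorphism from the free abelian group on `B`. -/
theorem exists_freeAbelianGroup_hom_perm {Q B : Type*} (τ : B → Equiv.Perm Q)
    (hτ : ∀ b c, τ b * τ c = τ c * τ b) :
    ∃ f : FreeAbelianGroup B →+ Additive (Equiv.Perm Q),
      ∀ b, f (FreeAbelianGroup.of b) = Additive.ofMul (τ b) := by
  let K := Subgroup.closure (Set.range τ)
  have hK : ∀ x ∈ Set.range τ, ∀ y ∈ Set.range τ, x * y = y * x := by
    rintro _ ⟨b, rfl⟩ _ ⟨c, rfl⟩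
    exact hτ b c
  have : IsMulCommutative K := Subgroup.isMulCommutative_closure hK
  let φ : FreeAbelianGroup B →+ Additive K := FreeAbelianGroup.lift fun b =>
    Additive.ofMul (⟨τ b, Subgroup.subset_closure ⟨b, rfl⟩⟩ : K)
  refine ⟨(MonoidHom.toAdditive K.subtype).comp φ, fun b => ?_⟩
  simp only [AddMonoidHom.comp_apply, φ, FreeAbelianGroup.lift_apply_of]
  rfl

/-- In a translation-commutative quandle, translations are constant on orbits. -/
theorem op_eq_op_of_eqvGen {Q : Type*} {op : Q → Q → Q}
    (h2 : ∀ y : Q, Function.Bijective (fun x : Q => op x y))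
    (h3 : ∀ w x y : Q, op (op w x) y = op (op w y) (op x y))
    (htc : ∀ x y z : Q, op (op x y) z = op (op x z) y) {y z : Q}
    (h : Relation.EqvGen (fun u v : Q => ∃ w : Q, v = op u w) y z) (x : Q) :
    op x y = op x z := by
  induction h with
  | rel u v huv =>
    obtain ⟨w, rfl⟩ := huv
    obtain ⟨x', rfl⟩ := (h2 w).2 x
    exact (htc x' w u).trans (h3 x' u w)
  | refl => rfl
  | symm _ _ _ ih => exact ih.symm
  | trans _ _ _ _ _ ih₁ ih₂ => exact ih₁.trans ih₂

/-- Theorem 2.7 (structure theorem): if `Q` is a translation-commutative quandle whose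
set of orbits is in bijection with a set `B` (here recorded by a surjection `ob : Q → B`
identifying orbits with fibers), then there is a family `S = (S_b)_{b ∈ B}` of subgroups
of `ℤ_B` with `b ∈ S_b` for all `b`, and a quandle isomorphism `Q ≅ Q(S)` carrying each
orbit `Q_b` onto the summand `A_b`. -/
theorem stmt9 {Q : Type*} [Nonempty Q] {B : Type*} (op : Q → Q → Q)
    (h1 : ∀ x : Q, op x x = x)
    (h2 : ∀ y : Q, Function.Bijective (fun x : Q => op x y))
    (h3 : ∀ w x y : Q, op (op w x) y = op (op w y) (op x y))
    (htc : ∀ x y z : Q, op (op x y) z = op (op x z) y)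
    (ob : Q → B) (hsurj : Function.Surjective ob)
    (horb : ∀ q q' : Q,
      ob q = ob q' ↔ Relation.EqvGen (fun u v : Q => ∃ w : Q, v = op u w) q q') :
    ∃ S : B → AddSubgroup (FreeAbelianGroup B),
      (∀ b : B, FreeAbelianGroup.of b ∈ S b) ∧
      ∃ g : Q ≃ QS S,
        (∀ x y : Q, g (op x y) = qsOp S (g x) (g y)) ∧
        (∀ q : Q, (g q).1 = ob q) := by
  have hop : ∀ x y z, ob y = ob z → op x y = op x z := fun x y z h =>
    op_eq_op_of_eqvGen h2 h3 htc ((horb y z).1 h) x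
  obtain ⟨r, hr⟩ := hsurj.hasRightInverse
  obtain ⟨f, hf⟩ := exists_freeAbelianGroup_hom_perm
    (fun b => Equiv.ofBijective (fun x => op x (r b)) (h2 (r b)))
    (fun b c => Equiv.ext fun x => htc x (r c) (r b))
  let act : FreeAbelianGroup B → Equiv.Perm Q := fun a => (f a).toMul
  have act_zero : ∀ x, act 0 x = x := fun x => by simp [act]
  have act_add : ∀ a a' x, act (a + a') x = act a (act a' x) := fun a a' x => by simp [act]
  have act_neg : ∀ a x y, act a x = y → act (-a) y = x := by
    rintro a x _ rfl
    rw [← act_add, neg_add_cancel, act_zero]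
  have act_of : ∀ x y, act (FreeAbelianGroup.of (ob y)) x = op x y := fun x y => by
    simp only [act, hf]
    exact hop x _ _ (hr _)
  have ob_op : ∀ x y, ob (op x y) = ob x := fun x y =>
    ((horb _ _).2 (.rel _ _ ⟨y, rfl⟩)).symm
  have ob_act : ∀ a x, ob (act a x) = ob x := by
    intro a
    induction a using FreeAbelianGroup.induction_on with
    | zero => exact fun x => by rw [act_zero]
    | of b =>
      intro x
      rw [← hr b, act_of, ob_op]
    | neg b ih =>
      intro x
      rw [← ih, ← act_add, add_neg_cancel, act_zero]
    | add a a' ih ih' =>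
      intro x
      rw [act_add, ih, ih']
  have exists_act : ∀ x y, ob x = ob y → ∃ a, act a x = y := by
    intro x y h
    induction (horb x y).1 h with
    | rel u v huv =>
      obtain ⟨w, rfl⟩ := huv
      exact ⟨_, act_of u w⟩
    | refl u => exact ⟨0, act_zero u⟩
    | symm u v huv ih =>
      obtain ⟨a, ha⟩ := ih ((horb _ _).2 huv)
      exact ⟨-a, act_neg a _ _ ha⟩
    | trans u v w huv hvw ih ih' =>
      obtain ⟨a, rfl⟩ := ih ((horb _ _).2 huv)
      obtain ⟨a', rfl⟩ := ih' ((horb _ _).2 hvw)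
      exact ⟨a' + a, act_add a' a u⟩
  let S : B → AddSubgroup (FreeAbelianGroup B) := fun b =>
    { carrier := {a | act a (r b) = r b}
      zero_mem' := act_zero _
      add_mem' := fun {a a'} ha ha' => by
        rw [Set.mem_ofPred_eq] at *
        rw [act_add, ha', ha]
      neg_mem' := fun {a} ha => act_neg a _ _ ha }
  have mem_S : ∀ a a' b, -a + a' ∈ S b ↔ act a (r b) = act a' (r b) := by
    intro a a' b
    change act (-a + a') (r b) = r b ↔ _
    rw [act_add]
    constructor
    · intro h
      have := act_neg (-a) _ _ h
      rwa [neg_neg] at this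
    · exact fun h => act_neg a _ _ h
  let G : QS S → Q := fun p => Quotient.liftOn' p.2 (fun a => act a (r p.1)) fun a a' h =>
    (mem_S a a' p.1).1 (QuotientAddGroup.leftRel_apply.1 h)
  have G_mk : ∀ b (a : FreeAbelianGroup B), G ⟨b, QuotientAddGroup.mk a⟩ = act a (r b) :=
    fun _ _ => rfl
  have ob_G : ∀ p, ob (G p) = p.1 := by
    rintro ⟨b, a⟩
    induction a using QuotientAddGroup.induction_on with | H a =>
    rw [G_mk, ob_act, hr]
  have G_op : ∀ p q, G (qsOp S p q) = op (G p) (G q) := by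
    rintro ⟨b, a⟩ q
    induction a using QuotientAddGroup.induction_on with | H a =>
    rw [qsOp, ← QuotientAddGroup.mk_add, G_mk, G_mk, add_comm, act_add, ← ob_G q, act_of]
  have G_bij : Function.Bijective G := by
    constructor
    · rintro ⟨b, a⟩ ⟨b', a'⟩ h
      obtain rfl : b = b' := by simpa only [ob_G] using congrArg ob h
      induction a using QuotientAddGroup.induction_on with | H a =>
      induction a' using QuotientAddGroup.induction_on with | H a' =>
      exact congrArg (Sigma.mk b) (QuotientAddGroup.eq.2 ((mem_S a a' b).2 h))
    · intro x
      obtain ⟨a, ha⟩ := exists_act (r (ob x)) x (hr _)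
      exact ⟨⟨ob x, QuotientAddGroup.mk a⟩, ha⟩
  let e := Equiv.ofBijective G G_bij
  have G_symm : ∀ x, G (e.symm x) = x := e.apply_symm_apply
  refine ⟨S, fun b => ?_, e.symm, fun x y => ?_, fun q => ?_⟩
  · change act (FreeAbelianGroup.of b) (r b) = r b
    have h := act_of (r b) (r b)
    rwa [hr b, h1] at h
  · rw [Equiv.symm_apply_eq]
    change _ = G _
    rw [G_op, G_symm, G_symm]
  · rw [← ob_G, G_symm]
end

section
/- Let n ≥ 2 be an integer and let a, c ∈ ℤ. Let B = {1, 2} and define S₁ to be the subgroup of ℤ_B generated by {b₁, a·b₂} and S₂ the subgroup generated by {b₂, c·b₁}, where b₁, b₂ are the free generators. Let X_n = Q(S'), where B' = {1, 2}, S'₁ = ℤ_{B'} (so A'₁ has one element) and S'₂ is the subgroup generated by {b'₂, n·b'₁} (so A'₂ ≅ ℤ/nℤ). Then the number of quandle homomorphisms from Q(S) to X_n equals n² + 1 + n·ε_a + n·ε_c, where ε_a = 1 if n divides a and ε_a = 0 otherwise, and similarly for ε_c. -/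
/-- The family of subgroups of `ℤ_{\{1,2\}}` describing the translation-commutative
quandle of a two-component link with linking numbers `a = ℓ_{2/1}` and `c = ℓ_{1/2}`:
`S₁ = ⟨b₁, a·b₂⟩` and `S₂ = ⟨b₂, c·b₁⟩`. -/
def linkS (a c : ℤ) : Fin 2 → AddSubgroup (FreeAbelianGroup (Fin 2)) :=
  ![AddSubgroup.closure {FreeAbelianGroup.of 0, a • FreeAbelianGroup.of 1},
    AddSubgroup.closure {FreeAbelianGroup.of 1, c • FreeAbelianGroup.of 0}]

/-- The family of subgroups describing the Harrell–Nelson target quandle `X_n`: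
`S'₁ = ℤ_{B'}` (so the first orbit is a single point) and `S'₂ = ⟨b'₂, n·b'₁⟩`
(so the second orbit has `n` elements). -/
def hnS (n : ℕ) : Fin 2 → AddSubgroup (FreeAbelianGroup (Fin 2)) :=
  ![⊤, AddSubgroup.closure {FreeAbelianGroup.of 1, (n : ℤ) • FreeAbelianGroup.of 0}]

/-- Affine maps over the homomorphism of free abelian groups induced by `φ`, as maps of quandles. -/
def qsAffine {B B' : Type*} {S : B → AddSubgroup (FreeAbelianGroup B)}
    {S' : B' → AddSubgroup (FreeAbelianGroup B')} (φ : B → B')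
    (hφ : ∀ b, S b ≤ (S' (φ b)).comap (FreeAbelianGroup.map φ))
    (y : ∀ b, FreeAbelianGroup B' ⧸ S' (φ b)) (x : QS S) : QS S' :=
  ⟨φ x.1, y x.1 + QuotientAddGroup.map _ _ (FreeAbelianGroup.map φ) (hφ x.1) x.2⟩

theorem qsAffine_qsOp {B B' : Type*} {S : B → AddSubgroup (FreeAbelianGroup B)}
    {S' : B' → AddSubgroup (FreeAbelianGroup B')} (φ : B → B')
    (hφ : ∀ b, S b ≤ (S' (φ b)).comap (FreeAbelianGroup.map φ))
    (y : ∀ b, FreeAbelianGroup B' ⧸ S' (φ b)) (x z : QS S) :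
    qsAffine φ hφ y (qsOp S x z) = qsOp S' (qsAffine φ hφ y x) (qsAffine φ hφ y z) := by
  obtain ⟨b, x⟩ := x
  have h : y b + QuotientAddGroup.map _ _ (FreeAbelianGroup.map φ) (hφ b)
      (x + QuotientAddGroup.mk (FreeAbelianGroup.of z.1)) =
      y b + QuotientAddGroup.map _ _ (FreeAbelianGroup.map φ) (hφ b) x +
        QuotientAddGroup.mk (FreeAbelianGroup.of (φ z.1)) := by
    rw [map_add, add_assoc, QuotientAddGroup.map_mk, FreeAbelianGroup.map_of_apply]
  exact congrArg (Sigma.mk (φ b)) h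

/-- A quandle homomorphism intertwines the translation actions of the free abelian groups. -/
theorem qsHom_translate {B B' : Type*} {S : B → AddSubgroup (FreeAbelianGroup B)}
    {S' : B' → AddSubgroup (FreeAbelianGroup B')} {f : QS S → QS S'}
    (hf : ∀ x y, f (qsOp S x y) = qsOp S' (f x) (f y)) (b : B) (g : FreeAbelianGroup B) :
    ∀ x : FreeAbelianGroup B ⧸ S b, f ⟨b, x + QuotientAddGroup.mk g⟩ =
      ⟨(f ⟨b, x⟩).1, (f ⟨b, x⟩).2 +
        QuotientAddGroup.mk (FreeAbelianGroup.map (fun c => (f ⟨c, 0⟩).1) g)⟩ := by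
  induction g using FreeAbelianGroup.induction_on with
  | zero => intro x; simp
  | of c =>
    intro x
    simpa [qsOp] using hf ⟨b, x⟩ ⟨c, 0⟩
  | neg c ih =>
    intro x
    have h := ih (x + QuotientAddGroup.mk (-FreeAbelianGroup.of c))
    rw [add_assoc, ← QuotientAddGroup.mk_add, neg_add_cancel, QuotientAddGroup.mk_zero,
      add_zero] at h
    rw [h]
    generalize f ⟨b, x + QuotientAddGroup.mk (-FreeAbelianGroup.of c)⟩ = p
    obtain ⟨d, z⟩ := p
    simp
  | add g h ihg ihh =>
    intro x
    rw [QuotientAddGroup.mk_add, ← add_assoc, ihh, ihg]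
    simp [add_assoc]

/-- Quandle homomorphisms `Q(S) → Q(S')` are the affine maps over the maps `φ : B → B'` whose
induced homomorphism carries each `S b` into `S' (φ b)`. -/
noncomputable def qsHomEquiv {B B' : Type*} (S : B → AddSubgroup (FreeAbelianGroup B))
    (S' : B' → AddSubgroup (FreeAbelianGroup B')) :
    ((φ : B → B') × ({_y : ∀ b, FreeAbelianGroup B' ⧸ S' (φ b) //
        ∀ b, S b ≤ (S' (φ b)).comap (FreeAbelianGroup.map φ)})) ≃
      {f : QS S → QS S' // ∀ x y, f (qsOp S x y) = qsOp S' (f x) (f y)} :=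
  Equiv.ofBijective (fun p => ⟨qsAffine p.1 p.2.2 p.2.1, qsAffine_qsOp p.1 p.2.2 p.2.1⟩) <| by
    constructor
    · rintro ⟨φ, y, hφ⟩ ⟨ψ, z, hψ⟩ h
      have key (b : B) : (⟨φ b, y b⟩ : QS S') = ⟨ψ b, z b⟩ := by
        simpa [qsAffine] using congrFun (congrArg Subtype.val h) ⟨b, 0⟩
      obtain rfl : φ = ψ := funext fun b => congrArg Sigma.fst (key b)
      obtain rfl : y = z := funext fun b => by simpa using key b
      rfl
    · rintro ⟨f, hf⟩
      refine ⟨⟨fun b => (f ⟨b, 0⟩).1, fun b => (f ⟨b, 0⟩).2, fun b g hg => ?_⟩, ?_⟩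
      · have h := qsHom_translate hf b g 0
        rw [(QuotientAddGroup.eq_zero_iff g).2 hg, add_zero] at h
        have h2 := eq_of_heq (Sigma.mk.inj h).2
        rwa [left_eq_add, QuotientAddGroup.eq_zero_iff] at h2
      · ext1
        funext ⟨b, x⟩
        induction x using QuotientAddGroup.induction_on with
        | H g => simpa [qsAffine] using (qsHom_translate hf b g 0).symm

open Classical in
/-- Counting quandle homomorphisms `Q(S) → Q(S')` by the induced map of orbits. -/
theorem card_qsHom {B B' : Type*} [Fintype B] [DecidableEq B] [Fintype B']
    (S : B → AddSubgroup (FreeAbelianGroup B)) (S' : B' → AddSubgroup (FreeAbelianGroup B'))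
    [∀ b, Finite (FreeAbelianGroup B' ⧸ S' b)] :
    Nat.card {f : QS S → QS S' // ∀ x y, f (qsOp S x y) = qsOp S' (f x) (f y)} =
      ∑ φ : B → B', if ∀ b, S b ≤ (S' (φ b)).comap (FreeAbelianGroup.map φ) then
        ∏ b, Nat.card (FreeAbelianGroup B' ⧸ S' (φ b)) else 0 := by
  rw [← Nat.card_congr (qsHomEquiv S S'), Nat.card_sigma]
  refine Finset.sum_congr rfl fun φ _ => ?_
  split_ifs with h
  · rw [Nat.card_congr (Equiv.subtypeUnivEquiv fun _ => h), Nat.card_pi]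
  · have : IsEmpty {_y : ∀ b, FreeAbelianGroup B' ⧸ S' (φ b) //
        ∀ b, S b ≤ (S' (φ b)).comap (FreeAbelianGroup.map φ)} := ⟨fun y => h y.2⟩
    exact Nat.card_of_isEmpty

theorem FreeAbelianGroup.exists_eq_zsmul_add_zsmul (g : FreeAbelianGroup (Fin 2)) :
    ∃ p q : ℤ, g = p • FreeAbelianGroup.of 0 + q • FreeAbelianGroup.of 1 := by
  induction g using FreeAbelianGroup.induction_on with
  | zero => exact ⟨0, 0, by simp⟩
  | of c =>
    fin_cases c
    · exact ⟨1, 0, by simp⟩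
    · exact ⟨0, 1, by simp⟩
  | neg c ih =>
    obtain ⟨p, q, h⟩ := ih
    exact ⟨-p, -q, by rw [h]; module⟩
  | add g h ihg ihh =>
    obtain ⟨p, q, hg⟩ := ihg
    obtain ⟨r, s, hh⟩ := ihh
    exact ⟨p + r, q + s, by rw [hg, hh]; module⟩

/-- The coefficient of the first generator, modulo `n`. -/
def firstCoeffMod (n : ℕ) : FreeAbelianGroup (Fin 2) →+ ZMod n :=
  FreeAbelianGroup.lift ![1, 0]

theorem hnS_one_eq_ker (n : ℕ) : hnS n 1 = (firstCoeffMod n).ker := by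
  change AddSubgroup.closure _ = _
  apply le_antisymm
  · rw [AddSubgroup.closure_le]
    rintro _ (rfl | rfl) <;> simp [-zsmul_eq_mul, -natCast_zsmul, map_zsmul, firstCoeffMod]
  · intro g hg
    obtain ⟨p, q, rfl⟩ := FreeAbelianGroup.exists_eq_zsmul_add_zsmul g
    have hp : (p : ZMod n) = 0 := by simpa [-zsmul_eq_mul, map_zsmul, firstCoeffMod] using hg
    obtain ⟨k, rfl⟩ := (ZMod.intCast_zmod_eq_zero_iff_dvd p n).1 hp
    refine add_mem ?_ (zsmul_mem (AddSubgroup.subset_closure (by simp)) q)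
    rw [mul_comm, mul_smul]
    exact zsmul_mem (AddSubgroup.subset_closure (by simp)) k

theorem card_quotient_hnS_zero (n : ℕ) : Nat.card (FreeAbelianGroup (Fin 2) ⧸ hnS n 0) = 1 :=
  AddSubgroup.index_top

theorem card_quotient_hnS_one (n : ℕ) : Nat.card (FreeAbelianGroup (Fin 2) ⧸ hnS n 1) = n := by
  have hsurj : Function.Surjective (firstCoeffMod n) := fun z => by
    obtain ⟨k, rfl⟩ := ZMod.intCast_surjective z
    exact ⟨k • FreeAbelianGroup.of 0, by simp [-zsmul_eq_mul, map_zsmul, firstCoeffMod]⟩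
  rw [hnS_one_eq_ker,
    Nat.card_congr (QuotientAddGroup.quotientKerEquivOfSurjective _ hsurj).toEquiv, Nat.card_zmod]

theorem linkS_zero_le_comap {a c : ℤ} {H : AddSubgroup (FreeAbelianGroup (Fin 2))}
    (φ : Fin 2 → Fin 2) : linkS a c 0 ≤ H.comap (FreeAbelianGroup.map φ) ↔
      FreeAbelianGroup.of (φ 0) ∈ H ∧ a • FreeAbelianGroup.of (φ 1) ∈ H := by
  simp [-zsmul_eq_mul, map_zsmul, linkS, AddSubgroup.closure_le, Set.insert_subset_iff]

theorem linkS_one_le_comap {a c : ℤ} {H : AddSubgroup (FreeAbelianGroup (Fin 2))}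
    (φ : Fin 2 → Fin 2) : linkS a c 1 ≤ H.comap (FreeAbelianGroup.map φ) ↔
      FreeAbelianGroup.of (φ 1) ∈ H ∧ c • FreeAbelianGroup.of (φ 0) ∈ H := by
  simp [-zsmul_eq_mul, map_zsmul, linkS, AddSubgroup.closure_le, Set.insert_subset_iff]

/-- Proposition 5.1 (Harrell–Nelson): the number of quandle homomorphisms from `Q(S)`
to `X_n` is `n² + 1 + n·ε_a + n·ε_c`, where `ε_a = 1` if `n ∣ a` and `0` otherwise,
and similarly for `ε_c`. -/
theorem stmt12 (n : ℕ) (hn : 2 ≤ n) (a c : ℤ) :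
    Nat.card {f : QS (linkS a c) → QS (hnS n) //
        ∀ x y : QS (linkS a c), f (qsOp (linkS a c) x y) = qsOp (hnS n) (f x) (f y)} =
      n ^ 2 + 1 + n * (if (n : ℤ) ∣ a then 1 else 0) + n * (if (n : ℤ) ∣ c then 1 else 0) := by
  have hfin (b : Fin 2) : Finite (FreeAbelianGroup (Fin 2) ⧸ hnS n b) := by
    apply Nat.finite_of_card_ne_zero
    fin_cases b
    · exact (card_quotient_hnS_zero n).trans_ne one_ne_zero
    · exact (card_quotient_hnS_one n).trans_ne (by lia)
  have h0 (g : FreeAbelianGroup (Fin 2)) : g ∈ hnS n 0 := AddSubgroup.mem_top g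
  have h1 (k : ℤ) : k • FreeAbelianGroup.of 0 ∈ hnS n 1 ↔ (n : ℤ) ∣ k := by
    simp [-zsmul_eq_mul, hnS_one_eq_ker, firstCoeffMod, ZMod.intCast_zmod_eq_zero_iff_dvd]
  have h2 : FreeAbelianGroup.of 1 ∈ hnS n 1 := by
    simp [-zsmul_eq_mul, hnS_one_eq_ker, firstCoeffMod]
  have h3 (k : ℤ) : k • FreeAbelianGroup.of 1 ∈ hnS n 1 := zsmul_mem h2 k
  rw [card_qsHom, ← (finTwoArrowEquiv (Fin 2)).symm.sum_comp]
  simp only [Fintype.sum_prod_type, Fin.sum_univ_two, Fin.forall_fin_two, Fin.prod_univ_two,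
    linkS_zero_le_comap, linkS_one_le_comap, finTwoArrowEquiv_symm_apply, Matrix.cons_val_zero,
    Matrix.cons_val_one, card_quotient_hnS_zero, card_quotient_hnS_one, h0, h1, h2, h3]
  split_ifs <;> simp_all <;> ring
end

section
/- Let n ≥ 2 be an integer and let a, c ∈ ℤ. Let B = {1, 2} with S₁ the subgroup of ℤ_B generated by {b₁, a·b₂} and S₂ the subgroup generated by {b₂, c·b₁}, and let X_n = Q(S') with B' = {1, 2}, S'₁ = ℤ_{B'} and S'₂ generated by {b'₂, n·b'₁}. Then the number of non-surjective quandle homomorphisms from Q(S) to X_n is exactly n² + 1, and each such homomorphism is constant on each of the two orbits A₁ and A₂ of Q(S). -/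
/-- A predicate on a quotient of a free abelian group that is invariant under translation by
the basis elements is constant. -/
lemma FreeAbelianGroup.quotient_iff_of_add_of {B : Type*} {H : AddSubgroup (FreeAbelianGroup B)}
    {P : FreeAbelianGroup B ⧸ H → Prop}
    (hP : ∀ z b, P (z + QuotientAddGroup.mk (FreeAbelianGroup.of b)) ↔ P z)
    (z w : FreeAbelianGroup B ⧸ H) : P z ↔ P w := by
  have key : ∀ (g : FreeAbelianGroup B) (z : FreeAbelianGroup B ⧸ H),
      P (z + QuotientAddGroup.mk g) ↔ P z := by
    intro g
    induction g using FreeAbelianGroup.induction_on with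
    | zero => intro z; simp
    | of b => intro z; exact hP z b
    | neg b ih =>
      intro z
      rw [← ih, QuotientAddGroup.mk_neg, neg_add_cancel_right]
    | add g h hg hh =>
      intro z
      rw [QuotientAddGroup.mk_add, ← add_assoc, hh, hg]
  obtain ⟨g, hg⟩ := QuotientAddGroup.mk_surjective (w - z)
  rw [← key g z, hg, add_sub_cancel]

section Hom

variable {B C : Type*} {S : B → AddSubgroup (FreeAbelianGroup B)}
  {T : C → AddSubgroup (FreeAbelianGroup C)} {f : QS S → QS T}

lemma qsOp_right_injective (y : QS T) : Function.Injective fun x => qsOp T x y := by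
  rintro ⟨b, x⟩ ⟨c, z⟩ h
  obtain rfl : b = c := congrArg Sigma.fst h
  simpa [qsOp] using h

/-- A homomorphism that meets every orbit of its codomain is surjective. -/
lemma surjective_of_forall_exists_fst_eq
    (hf : ∀ x y, f (qsOp S x y) = qsOp T (f x) (f y)) (h : ∀ c, ∃ x, (f x).1 = c) :
    Function.Surjective f := by
  rintro ⟨c, w⟩
  obtain ⟨x, rfl⟩ := h c
  refine (FreeAbelianGroup.quotient_iff_of_add_of (P := fun w => ∃ z, f z = ⟨(f x).1, w⟩)
    (fun w d => ?_) (f x).2 w).1 ⟨x, rfl⟩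
  obtain ⟨y, rfl⟩ := h d
  constructor
  · rintro ⟨z, hz⟩
    refine ⟨⟨z.1, z.2 - QuotientAddGroup.mk (FreeAbelianGroup.of y.1)⟩,
      qsOp_right_injective (f y) ?_⟩
    change qsOp T _ _ = qsOp T _ _
    rw [← hf]
    simpa [qsOp] using hz
  · rintro ⟨z, hz⟩
    exact ⟨qsOp S z y, by rw [hf, hz]; rfl⟩

/-- A homomorphism into a single orbit is constant on orbits. -/
lemma eq_of_fst_eq_of_forall_fst_eq (hT : ∀ c, FreeAbelianGroup.of c ∈ T c)
    (hf : ∀ x y, f (qsOp S x y) = qsOp T (f x) (f y)) {d : C} (hd : ∀ x, (f x).1 = d)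
    {x y : QS S} (hxy : x.1 = y.1) : f x = f y := by
  obtain ⟨b, x⟩ := x
  obtain ⟨c, y⟩ := y
  obtain rfl : b = c := hxy
  refine (FreeAbelianGroup.quotient_iff_of_add_of (P := fun w => f ⟨b, w⟩ = f ⟨b, y⟩)
    (fun w e => ?_) x y).2 rfl
  suffices f ⟨b, w + QuotientAddGroup.mk (FreeAbelianGroup.of e)⟩ = f ⟨b, w⟩ by rw [this]
  refine (hf ⟨b, w⟩ ⟨e, 0⟩).trans ?_
  have hmem : (QuotientAddGroup.mk (FreeAbelianGroup.of (f ⟨e, 0⟩).1) :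
      FreeAbelianGroup C ⧸ T (f ⟨b, w⟩).1) = 0 := by
    rw [QuotientAddGroup.eq_zero_iff, hd ⟨e, 0⟩, hd ⟨b, w⟩]
    exact hT d
  rw [qsOp, hmem, add_zero]

/-- A map that is constant on orbits, with values in a single orbit, is a homomorphism. -/
lemma map_qsOp_of_orbit_const (hT : ∀ c, FreeAbelianGroup.of c ∈ T c) (d : C)
    (g : B → FreeAbelianGroup C ⧸ T d) (x y : QS S) :
    (⟨d, g (qsOp S x y).1⟩ : QS T) = qsOp T ⟨d, g x.1⟩ ⟨d, g y.1⟩ := by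
  have hmem : (QuotientAddGroup.mk (FreeAbelianGroup.of d) : FreeAbelianGroup C ⧸ T d) = 0 :=
    (QuotientAddGroup.eq_zero_iff _).2 (hT d)
  simp [qsOp, hmem]

end Hom

/-- A non-surjective homomorphism into a quandle with two orbits has its image in one orbit. -/
lemma exists_forall_fst_eq_of_not_surjective {B : Type*}
    {S : B → AddSubgroup (FreeAbelianGroup B)} {T : Fin 2 → AddSubgroup (FreeAbelianGroup (Fin 2))}
    {f : QS S → QS T} (hf : ∀ x y, f (qsOp S x y) = qsOp T (f x) (f y))
    (hs : ¬ Function.Surjective f) : ∃ d, ∀ x, (f x).1 = d := by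
  have h : ∃ c, ∀ x, (f x).1 ≠ c := by
    by_contra! h
    exact hs (surjective_of_forall_exists_fst_eq hf h)
  obtain ⟨c, hc⟩ := h
  exact ⟨1 - c, fun x => by have := hc x; lia⟩

/-- Non-surjective homomorphisms into a quandle with two orbits correspond to the choice of an
orbit `d` of the codomain and, for every orbit of the domain, of an element of `d`. -/
lemma card_not_surjective_hom {B : Type*} {S : B → AddSubgroup (FreeAbelianGroup B)}
    {T : Fin 2 → AddSubgroup (FreeAbelianGroup (Fin 2))}
    (hT : ∀ c, FreeAbelianGroup.of c ∈ T c) [Nonempty B] :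
    Nat.card {f : QS S → QS T //
      (∀ x y, f (qsOp S x y) = qsOp T (f x) (f y)) ∧ ¬ Function.Surjective f} =
    Nat.card ((d : Fin 2) × (B → FreeAbelianGroup (Fin 2) ⧸ T d)) := by
  symm
  refine Nat.card_congr (Equiv.ofBijective
    (fun p => ⟨fun x => ⟨p.1, p.2 x.1⟩, map_qsOp_of_orbit_const hT p.1 p.2, fun h => ?_⟩)
    ⟨?_, ?_⟩)
  · obtain ⟨c, hc⟩ := exists_ne p.1
    obtain ⟨x, hx⟩ := h ⟨c, 0⟩
    exact hc (congrArg Sigma.fst hx).symm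
  · rintro ⟨d, g⟩ ⟨e, h⟩ hgh
    have hx : ∀ b : B, (⟨d, g b⟩ : QS T) = ⟨e, h b⟩ := fun b =>
      congrFun (congrArg Subtype.val hgh) ⟨b, 0⟩
    obtain rfl : d = e := congrArg Sigma.fst (hx (Classical.arbitrary B))
    congr 1
    funext b
    simpa using hx b
  · rintro ⟨f, hf, hs⟩
    obtain ⟨d, hd⟩ := exists_forall_fst_eq_of_not_surjective hf hs
    have h : ∀ b, ∃ w, (⟨d, w⟩ : QS T) = f ⟨b, 0⟩ := fun b => by
      rw [← hd ⟨b, 0⟩]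
      exact ⟨_, rfl⟩
    choose g hg using h
    exact ⟨⟨d, g⟩, Subtype.ext (funext fun x =>
      (hg x.1).trans (eq_of_fst_eq_of_forall_fst_eq hT hf hd rfl))⟩

/-- The group `⟨b₁, b₂ | b₂, n·b₁⟩` is cyclic of order `n`. -/
lemma card_quotient_closure (n : ℕ) :
    Nat.card (FreeAbelianGroup (Fin 2) ⧸ AddSubgroup.closure
      {FreeAbelianGroup.of (1 : Fin 2), (n : ℤ) • FreeAbelianGroup.of 0}) = n := by
  let φ : FreeAbelianGroup (Fin 2) →+ ZMod n := FreeAbelianGroup.lift ![1, 0]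
  have h0 : φ (FreeAbelianGroup.of 0) = 1 := by simp [φ]
  have h1 : φ (FreeAbelianGroup.of 1) = 0 := by simp [φ]
  have hφ : Function.Surjective φ := fun z => by
    obtain ⟨m, rfl⟩ := ZMod.intCast_surjective z
    exact ⟨m • FreeAbelianGroup.of 0, by rw [map_zsmul, h0, zsmul_one]⟩
  have hker : AddSubgroup.closure
      {FreeAbelianGroup.of (1 : Fin 2), (n : ℤ) • FreeAbelianGroup.of 0} = φ.ker := by
    apply le_antisymm
    · rw [AddSubgroup.closure_le]
      rintro x (rfl | rfl)
      · exact h1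
      · change φ _ = 0
        rw [map_zsmul, h0, zsmul_one, Int.cast_natCast, ZMod.natCast_self]
    · intro x hx
      obtain ⟨m, k, rfl⟩ : ∃ m k : ℤ,
          x = m • FreeAbelianGroup.of 0 + k • FreeAbelianGroup.of 1 := by
        clear hx
        induction x using FreeAbelianGroup.induction_on with
        | zero => exact ⟨0, 0, by simp⟩
        | of b =>
          fin_cases b
          · exact ⟨1, 0, by simp⟩
          · exact ⟨0, 1, by simp⟩
        | neg b ih =>
          obtain ⟨m, k, h⟩ := ih
          exact ⟨-m, -k, by rw [h]; module⟩
        | add x y hx hy =>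
          obtain ⟨m, k, rfl⟩ := hx
          obtain ⟨m', k', rfl⟩ := hy
          exact ⟨m + m', k + k', by module⟩
      have hm : (m : ZMod n) = 0 := by
        rwa [AddMonoidHom.mem_ker, map_add, map_zsmul, map_zsmul, h0, h1, zsmul_one, smul_zero,
          add_zero] at hx
      obtain ⟨l, rfl⟩ := (ZMod.intCast_zmod_eq_zero_iff_dvd m n).1 hm
      rw [mul_zsmul']
      refine add_mem (zsmul_mem ?_ l) (zsmul_mem ?_ k) <;> apply AddSubgroup.subset_closure
      · exact Set.mem_insert_of_mem _ rfl
      · exact Set.mem_insert _ _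
  rw [hker, Nat.card_congr (QuotientAddGroup.quotientKerEquivOfSurjective φ hφ).toEquiv,
    Nat.card_zmod]

lemma of_mem_hnS (n : ℕ) (c : Fin 2) : FreeAbelianGroup.of c ∈ hnS n c := by
  fin_cases c
  · exact AddSubgroup.mem_top _
  · exact AddSubgroup.subset_closure (Set.mem_insert _ _)

/-- There are exactly `n² + 1` non-surjective quandle homomorphisms `Q(S) → X_n`, and
each of them is constant on each of the two orbits `A₁`, `A₂` of `Q(S)`. -/
theorem stmt13 (n : ℕ) (hn : 2 ≤ n) (a c : ℤ) :
    Nat.card {f : QS (linkS a c) → QS (hnS n) //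
        (∀ x y : QS (linkS a c), f (qsOp (linkS a c) x y) = qsOp (hnS n) (f x) (f y)) ∧
        ¬ Function.Surjective f} = n ^ 2 + 1 ∧
    ∀ f : QS (linkS a c) → QS (hnS n),
      (∀ x y : QS (linkS a c), f (qsOp (linkS a c) x y) = qsOp (hnS n) (f x) (f y)) →
      ¬ Function.Surjective f →
      ∀ x y : QS (linkS a c), x.1 = y.1 → f x = f y := by
  refine ⟨?_, fun f hf hs x y hxy => ?_⟩
  · have h0 : Nat.card (FreeAbelianGroup (Fin 2) ⧸ hnS n 0) = 1 :=
      AddSubgroup.index_top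
    have h1 : Nat.card (FreeAbelianGroup (Fin 2) ⧸ hnS n 1) = n := card_quotient_closure n
    have : ∀ d, Finite (FreeAbelianGroup (Fin 2) ⧸ hnS n d) := by
      refine Fin.forall_fin_two.2 ⟨?_, ?_⟩ <;> apply Nat.finite_of_card_ne_zero <;> lia
    rw [card_not_surjective_hom (of_mem_hnS n), Nat.card_sigma, Fin.sum_univ_two,
      Nat.card_fun, Nat.card_fun, h0, h1, Nat.card_fin, one_pow, add_comm]
  · obtain ⟨d, hd⟩ := exists_forall_fst_eq_of_not_surjective hf hs
    exact eq_of_fst_eq_of_forall_fst_eq (of_mem_hnS n) hf hd hxy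
end

section
/- Let n ≥ 2 be an integer and let a, c ∈ ℤ. Let B = {1, 2} with S₁ the subgroup of ℤ_B generated by {b₁, a·b₂} and S₂ the subgroup generated by {b₂, c·b₁}, and let X_n = Q(S') with B' = {1, 2}, S'₁ = ℤ_{B'} and S'₂ generated by {b'₂, n·b'₁}. If n divides a, then there are exactly n surjective quandle homomorphisms Q(S) → X_n that map the orbit A₁ onto the n-element orbit A'₂ of X_n and map the orbit A₂ onto the one-element orbit A'₁; symmetrically, if n divides c, there are exactly n surjective quandle homomorphisms mapping A₂ onto A'₂ and A₁ onto A'₁; and every surjective quandle homomorphism Q(S) → X_n is of one of these two kinds. -/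
section OrbitMap

variable {B B' : Type*} {S : B → AddSubgroup (FreeAbelianGroup B)}
  {S' : B' → AddSubgroup (FreeAbelianGroup B')}

/-- A map `Q(S) → Q(S')` is a quandle homomorphism. -/
def IsQSHom (f : QS S → QS S') : Prop :=
  ∀ x y : QS S, f (qsOp S x y) = qsOp S' (f x) (f y)

theorem IsQSHom.fst_add_mk {f : QS S → QS S'} (hf : IsQSHom f) (b : B)
    (g : FreeAbelianGroup B) (x : FreeAbelianGroup B ⧸ S b) :
    (f ⟨b, x + QuotientAddGroup.mk g⟩).1 = (f ⟨b, x⟩).1 := by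
  induction g using FreeAbelianGroup.induction_on generalizing x with
  | zero => simp
  | of c =>
    have h := congrArg Sigma.fst (hf ⟨b, x⟩ ⟨c, 0⟩)
    exact h
  | neg c h =>
    have h' := h (x + QuotientAddGroup.mk (-FreeAbelianGroup.of c))
    rw [add_assoc, ← QuotientAddGroup.mk_add, neg_add_cancel, QuotientAddGroup.mk_zero,
      add_zero] at h'
    exact h'.symm
  | add g h hg hh => rw [QuotientAddGroup.mk_add, ← add_assoc, hh, hg]

theorem IsQSHom.fst_eq {f : QS S → QS S'} (hf : IsQSHom f) (x : QS S) :
    (f x).1 = (f ⟨x.1, 0⟩).1 := by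
  obtain ⟨b, x⟩ := x
  induction x using QuotientAddGroup.induction_on with
  | H g => simpa using hf.fst_add_mk b g 0

theorem exists_eq_mk_of_fst_eq {f : QS S → QS S'} {σ : B → B'}
    (hσ : ∀ x, (f x).1 = σ x.1) (b : B) (x : FreeAbelianGroup B ⧸ S b) :
    ∃ s, f ⟨b, x⟩ = ⟨σ b, s⟩ := by
  have h := hσ ⟨b, x⟩
  generalize f ⟨b, x⟩ = y at h
  obtain ⟨d, y⟩ := y
  obtain rfl : d = σ b := h
  exact ⟨y, rfl⟩

/-- A homomorphism is a translate of the map induced by its orbit map. -/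
theorem IsQSHom.apply_add_mk {f : QS S → QS S'} (hf : IsQSHom f) {σ : B → B'}
    (hσ : ∀ x, (f x).1 = σ x.1) (b : B) (g : FreeAbelianGroup B)
    (x : FreeAbelianGroup B ⧸ S b) (s : FreeAbelianGroup B' ⧸ S' (σ b))
    (hx : f ⟨b, x⟩ = ⟨σ b, s⟩) :
    f ⟨b, x + QuotientAddGroup.mk g⟩ =
      ⟨σ b, s + QuotientAddGroup.mk (FreeAbelianGroup.map σ g)⟩ := by
  induction g using FreeAbelianGroup.induction_on generalizing x s with
  | zero => simpa using hx
  | of c =>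
    have h := hf ⟨b, x⟩ ⟨c, 0⟩
    rw [hx] at h
    simpa [qsOp, hσ] using h
  | neg c h =>
    obtain ⟨s', hs'⟩ := exists_eq_mk_of_fst_eq hσ b
      (x + QuotientAddGroup.mk (-FreeAbelianGroup.of c))
    have h' := h _ _ hs'
    rw [add_assoc, ← QuotientAddGroup.mk_add, neg_add_cancel, QuotientAddGroup.mk_zero,
      add_zero, hx] at h'
    obtain rfl := eq_of_heq (Sigma.mk.inj h').2
    rw [hs', add_assoc, ← QuotientAddGroup.mk_add, ← map_add, add_neg_cancel]
    simp
  | add g h hg hh =>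
    rw [QuotientAddGroup.mk_add, ← add_assoc, hh _ _ (hg _ _ hx), map_add,
      QuotientAddGroup.mk_add, add_assoc]

/-- The homomorphism over `σ` with prescribed values at the base points of the orbits. -/
def qsHomOfBase (σ : B → B') (h : ∀ b, S b ≤ (S' (σ b)).comap (FreeAbelianGroup.map σ))
    (t : ∀ b, FreeAbelianGroup B' ⧸ S' (σ b)) (x : QS S) : QS S' :=
  ⟨σ x.1, t x.1 + QuotientAddGroup.map _ _ (FreeAbelianGroup.map σ) (h x.1) x.2⟩

theorem isQSHom_qsHomOfBase (σ : B → B')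
    (h : ∀ b, S b ≤ (S' (σ b)).comap (FreeAbelianGroup.map σ))
    (t : ∀ b, FreeAbelianGroup B' ⧸ S' (σ b)) : IsQSHom (qsHomOfBase σ h t) := by
  rintro ⟨b, x⟩ ⟨c, y⟩
  let φ := QuotientAddGroup.map _ _ (FreeAbelianGroup.map σ) (h b)
  have key : t b + φ (x + QuotientAddGroup.mk (FreeAbelianGroup.of c)) =
      t b + φ x + QuotientAddGroup.mk (FreeAbelianGroup.of (σ c)) := by
    rw [map_add, ← add_assoc, QuotientAddGroup.map_mk, FreeAbelianGroup.map_of_apply]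
  exact congrArg (Sigma.mk (σ b)) key

/-- Homomorphisms over `σ` are freely determined by the values at the base points. -/
theorem card_isQSHom_over [Fintype B] (σ : B → B')
    (h : ∀ b, S b ≤ (S' (σ b)).comap (FreeAbelianGroup.map σ)) :
    Nat.card {f : QS S → QS S' // IsQSHom f ∧ ∀ x, (f x).1 = σ x.1} =
      ∏ b, Nat.card (FreeAbelianGroup B' ⧸ S' (σ b)) := by
  rw [← Nat.card_pi]
  symm
  refine Nat.card_congr (Equiv.ofBijective
    (fun t => ⟨qsHomOfBase σ h t, isQSHom_qsHomOfBase σ h t, fun _ => rfl⟩) ⟨?_, ?_⟩)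
  · intro t t' htt
    funext b
    have := congrFun (congrArg Subtype.val htt) ⟨b, 0⟩
    simpa [qsHomOfBase] using this
  · rintro ⟨f, hf, hσ⟩
    choose t ht using fun b => exists_eq_mk_of_fst_eq hσ b 0
    refine ⟨t, Subtype.ext (funext ?_)⟩
    rintro ⟨b, x⟩
    induction x using QuotientAddGroup.induction_on with
    | H g => simpa [qsHomOfBase] using (hf.apply_add_mk hσ b g 0 (t b) (ht b)).symm

theorem IsQSHom.surjective_of_surjective {f : QS S → QS S'} (hf : IsQSHom f) {σ : B → B'}
    (hσ : ∀ x, (f x).1 = σ x.1) (hs : Function.Surjective σ) : Function.Surjective f := by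
  rintro ⟨d, y⟩
  obtain ⟨b, rfl⟩ := hs d
  obtain ⟨s, hx⟩ := exists_eq_mk_of_fst_eq hσ b 0
  obtain ⟨u, hu⟩ := QuotientAddGroup.mk_surjective (y - s)
  have hmap : Function.Surjective (FreeAbelianGroup.map σ) := fun v => by
    refine ⟨FreeAbelianGroup.map (Function.surjInv hs) v, ?_⟩
    rw [← AddMonoidHom.comp_apply, ← FreeAbelianGroup.map_comp,
      (Function.rightInverse_surjInv hs).comp_eq_id, FreeAbelianGroup.map_id]
    rfl
  obtain ⟨g, rfl⟩ := hmap u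
  refine ⟨⟨b, 0 + QuotientAddGroup.mk g⟩, ?_⟩
  rw [hf.apply_add_mk hσ b g 0 s hx, hu, add_sub_cancel]

theorem image_orbit_eq {f : QS S → QS S'} (hf : Function.Surjective f) {σ : B → B'}
    (hσ : ∀ x, (f x).1 = σ x.1) (hi : Function.Injective σ) (b : B) :
    f '' {x : QS S | x.1 = b} = {y : QS S' | y.1 = σ b} := by
  ext y
  constructor
  · rintro ⟨x, rfl, rfl⟩
    exact hσ x
  · intro hy
    obtain ⟨x, rfl⟩ := hf y
    exact ⟨x, hi ((hσ x).symm.trans hy), rfl⟩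

end OrbitMap

theorem exists_zsmul_of_add_zsmul_of (g : FreeAbelianGroup (Fin 2)) :
    ∃ x y : ℤ, g = x • FreeAbelianGroup.of 0 + y • FreeAbelianGroup.of 1 := by
  induction g using FreeAbelianGroup.induction_on with
  | zero => exact ⟨0, 0, by simp⟩
  | of c =>
    fin_cases c
    · exact ⟨1, 0, by simp⟩
    · exact ⟨0, 1, by simp⟩
  | neg c h =>
    obtain ⟨x, y, h⟩ := h
    exact ⟨-x, -y, by rw [h]; module⟩
  | add g h hg hh =>
    obtain ⟨x, y, rfl⟩ := hg
    obtain ⟨x', y', rfl⟩ := hh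
    exact ⟨x + x', y + y', by module⟩

theorem hnS_one_eq_ker_s14 (n : ℕ) :
    hnS n 1 = (FreeAbelianGroup.lift (![1, 0] : Fin 2 → ZMod n)).ker := by
  apply le_antisymm
  · refine (AddSubgroup.closure_le _).2 ?_
    rintro _ (rfl | rfl) <;> simp [AddMonoidHom.mem_ker, -zsmul_eq_mul, -natCast_zsmul, map_zsmul]
  · intro g hg
    obtain ⟨x, y, rfl⟩ := exists_zsmul_of_add_zsmul_of g
    have hx : (x : ZMod n) = 0 := by
      simpa [AddMonoidHom.mem_ker, -zsmul_eq_mul, map_zsmul] using hg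
    obtain ⟨k, rfl⟩ := (ZMod.intCast_zmod_eq_zero_iff_dvd x n).1 hx
    rw [mul_comm, mul_smul]
    exact add_mem (zsmul_mem (AddSubgroup.subset_closure (by simp)) k)
      (zsmul_mem (AddSubgroup.subset_closure (by simp)) y)

theorem smul_of_zero_mem_hnS_one {n : ℕ} {a : ℤ} (h : (n : ℤ) ∣ a) :
    a • FreeAbelianGroup.of 0 ∈ hnS n 1 := by
  obtain ⟨k, rfl⟩ := h
  rw [mul_comm, mul_smul]
  exact zsmul_mem (AddSubgroup.subset_closure (by simp)) k

theorem of_one_mem_hnS_one (n : ℕ) : FreeAbelianGroup.of 1 ∈ hnS n 1 :=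
  AddSubgroup.subset_closure (by simp)

/-- The surjective homomorphisms `Q(S) → X_n` inducing a given bijection of orbits number `n`,
as soon as the bijection is compatible with the families of subgroups. -/
theorem card_surjective_isQSHom_hnS {S : Fin 2 → AddSubgroup (FreeAbelianGroup (Fin 2))} (n : ℕ)
    (σ : Equiv.Perm (Fin 2))
    (h : ∀ b, S b ≤ (hnS n (σ b)).comap (FreeAbelianGroup.map σ)) :
    Nat.card {f : QS S → QS (hnS n) // IsQSHom f ∧ Function.Surjective f ∧
      f '' {x : QS S | x.1 = σ.symm 1} = {y : QS (hnS n) | y.1 = 1} ∧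
      f '' {x : QS S | x.1 = σ.symm 0} = {y : QS (hnS n) | y.1 = 0}} = n := by
  have key := card_isQSHom_over (S' := hnS n) σ h
  rw [Equiv.prod_comp σ (fun b => Nat.card (FreeAbelianGroup (Fin 2) ⧸ hnS n b)),
    Fin.prod_univ_two, card_quotient_hnS_zero, card_quotient_hnS_one, one_mul] at key
  refine Eq.trans (Nat.card_congr (Equiv.subtypeEquivRight fun f => ?_)) key
  refine and_congr_right fun hf => ⟨?_, fun hσ => ?_⟩
  · rintro ⟨-, h1, h0⟩ x
    obtain ⟨b, hb⟩ := σ.symm.surjective x.1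
    rw [← hb, Equiv.apply_symm_apply]
    obtain rfl | rfl : b = 0 ∨ b = 1 := by omega
    · exact h0.subset ⟨x, hb.symm, rfl⟩
    · exact h1.subset ⟨x, hb.symm, rfl⟩
  · have hs := hf.surjective_of_surjective hσ σ.surjective
    have himg (d : Fin 2) := image_orbit_eq hs hσ σ.injective (σ.symm d)
    simp only [Equiv.apply_symm_apply] at himg
    exact ⟨hs, himg 1, himg 0⟩

/-- If `n ∣ a`, there are exactly `n` surjective quandle homomorphisms `Q(S) → X_n`
carrying the orbit `A₁` onto the `n`-element orbit `A'₂` and the orbit `A₂` onto the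
one-element orbit `A'₁`; symmetrically for `n ∣ c`; and every surjective quandle
homomorphism `Q(S) → X_n` is of one of these two kinds. -/
theorem stmt14 (n : ℕ) (hn : 2 ≤ n) (a c : ℤ) :
    ((n : ℤ) ∣ a →
      Nat.card {f : QS (linkS a c) → QS (hnS n) //
        (∀ x y : QS (linkS a c), f (qsOp (linkS a c) x y) = qsOp (hnS n) (f x) (f y)) ∧
        Function.Surjective f ∧
        f '' {x : QS (linkS a c) | x.1 = 0} = {y : QS (hnS n) | y.1 = 1} ∧
        f '' {x : QS (linkS a c) | x.1 = 1} = {y : QS (hnS n) | y.1 = 0}} = n) ∧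
    ((n : ℤ) ∣ c →
      Nat.card {f : QS (linkS a c) → QS (hnS n) //
        (∀ x y : QS (linkS a c), f (qsOp (linkS a c) x y) = qsOp (hnS n) (f x) (f y)) ∧
        Function.Surjective f ∧
        f '' {x : QS (linkS a c) | x.1 = 1} = {y : QS (hnS n) | y.1 = 1} ∧
        f '' {x : QS (linkS a c) | x.1 = 0} = {y : QS (hnS n) | y.1 = 0}} = n) ∧
    (∀ f : QS (linkS a c) → QS (hnS n),
      (∀ x y : QS (linkS a c), f (qsOp (linkS a c) x y) = qsOp (hnS n) (f x) (f y)) →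
      Function.Surjective f →
      (f '' {x : QS (linkS a c) | x.1 = 0} = {y : QS (hnS n) | y.1 = 1} ∧
        f '' {x : QS (linkS a c) | x.1 = 1} = {y : QS (hnS n) | y.1 = 0}) ∨
      (f '' {x : QS (linkS a c) | x.1 = 1} = {y : QS (hnS n) | y.1 = 1} ∧
        f '' {x : QS (linkS a c) | x.1 = 0} = {y : QS (hnS n) | y.1 = 0})) := by
  refine ⟨fun ha => ?_, fun hc => ?_, fun f hf hs => ?_⟩
  · refine card_surjective_isQSHom_hnS (S := linkS a c) n (Equiv.swap 0 1) fun b => ?_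
    fin_cases b
    · refine (AddSubgroup.closure_le _).2 ?_
      rintro _ (rfl | rfl)
      · simpa using of_one_mem_hnS_one n
      · simpa [-zsmul_eq_mul, map_zsmul] using smul_of_zero_mem_hnS_one ha
    · intro g _
      exact AddSubgroup.mem_top _
  · refine card_surjective_isQSHom_hnS (S := linkS a c) n (Equiv.refl _) fun b => ?_
    fin_cases b
    · intro g _
      exact AddSubgroup.mem_top _
    · refine (AddSubgroup.closure_le _).2 ?_
      rintro _ (rfl | rfl)
      · simpa using of_one_mem_hnS_one n
      · simpa [-zsmul_eq_mul, map_zsmul] using smul_of_zero_mem_hnS_one hc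
  · have hf' : IsQSHom f := hf
    obtain ⟨σ, hσ⟩ : ∃ σ : Fin 2 → Fin 2, ∀ x, (f x).1 = σ x.1 :=
      ⟨fun b => (f ⟨b, 0⟩).1, hf'.fst_eq⟩
    have hsurj : Function.Surjective σ := fun d => by
      obtain ⟨x, hx⟩ := hs ⟨d, 0⟩
      exact ⟨x.1, by rw [← hσ, hx]⟩
    have hinj : Function.Injective σ := Finite.injective_iff_surjective.2 hsurj
    have h01 : σ 0 ≠ σ 1 := hinj.ne (by decide)
    have h0 := image_orbit_eq hs hσ hinj 0
    have h1 := image_orbit_eq hs hσ hinj 1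
    obtain ⟨e0, e1⟩ | ⟨e0, e1⟩ : (σ 0 = 1 ∧ σ 1 = 0) ∨ (σ 0 = 0 ∧ σ 1 = 1) := by omega
    · rw [e0] at h0
      rw [e1] at h1
      exact Or.inl ⟨h0, h1⟩
    · rw [e0] at h0
      rw [e1] at h1
      exact Or.inr ⟨h1, h0⟩
end
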